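/- arXiv:2308.08026 — 2 statements merged into one kernel-verified Lean document; each statement's English description precedes it below -/
import Mathlib

section
/- Let X and Y be ℂ-vector spaces and φ : B⊗̂X → B⊗̂Y a B-linear map whose leading term φ₀ : X → Y is injective. Then the image φ(B⊗̂X) is a closed subset of B⊗̂Y in the 𝔪-adic topology. -/
/-!
`B` is a "deformation base": a commutative Noetherian local ℂ-algebra, complete in the
`𝔪`-adic topology, with residue field `ℂ`.  For a ℂ-vector space `X`, the completed
tensor product `B ⊗̂ X` is the `𝔪`-adic completion of `B ⊗[ℂ] X`, realized as the
inverse limit of the modules `(B ⊗[ℂ] X) ⧸ 𝔪^k (B ⊗[ℂ] X) ≅ B/𝔪^k ⊗[ℂ] X`.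
-/

open scoped TensorProduct
open IsLocalRing

/-- The completed tensor product `B ⊗̂ X`. -/
noncomputable abbrev CTP (B : Type) [CommRing B] [Algebra ℂ B] [IsLocalRing B]
    (X : Type) [AddCommGroup X] [Module ℂ X] : Type :=
  AdicCompletion (maximalIdeal B) (B ⊗[ℂ] X)

/-- The canonical embedding `X → B ⊗̂ X`, `x ↦ 1 ⊗ x`. -/
noncomputable def iota (B : Type) [CommRing B] [Algebra ℂ B] [IsLocalRing B]
    (X : Type) [AddCommGroup X] [Module ℂ X] (x : X) : CTP B X :=
  AdicCompletion.of (maximalIdeal B) (B ⊗[ℂ] X) ((1 : B) ⊗ₜ x)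

/-- The submodule `𝔪^k X ⊆ B ⊗̂ X`: the kernel of the canonical projection
`B ⊗̂ X → (B ⊗[ℂ] X) ⧸ 𝔪^k (B ⊗[ℂ] X) ≅ B/𝔪^k ⊗[ℂ] X`. -/
noncomputable def mpow (B : Type) [CommRing B] [Algebra ℂ B] [IsLocalRing B]
    (X : Type) [AddCommGroup X] [Module ℂ X] (k : ℕ) : Submodule B (CTP B X) :=
  LinearMap.ker (AdicCompletion.eval (maximalIdeal B) (B ⊗[ℂ] X) k)

/-- The `𝔪`-adic topology on `B ⊗̂ X`, generated by the cosets `x + 𝔪^k X`. -/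
noncomputable def adicTop (B : Type) [CommRing B] [Algebra ℂ B] [IsLocalRing B]
    (X : Type) [AddCommGroup X] [Module ℂ X] : TopologicalSpace (CTP B X) :=
  TopologicalSpace.generateFrom
    {s | ∃ (x : CTP B X) (k : ℕ), s = {y | y - x ∈ mpow B X k}}

section Filtration

variable {B : Type} [CommRing B] [Algebra ℂ B] [IsLocalRing B]
variable {X Y : Type} [AddCommGroup X] [Module ℂ X] [AddCommGroup Y] [Module ℂ Y]

theorem eq_zero_of_forall_mem_mpow {x : CTP B X} (hx : ∀ k, x ∈ mpow B X k) : x = 0 :=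
  AdicCompletion.ext fun k => hx k

theorem isClosed_adicTop {s : Set (CTP B X)}
    (hs : ∀ y, (∀ k, ∃ x ∈ s, x - y ∈ mpow B X k) → y ∈ s) : @IsClosed _ (adicTop B X) s := by
  let := adicTop B X
  rw [← isOpen_compl_iff, isOpen_iff_forall_mem_open]
  intro y hy
  obtain ⟨k, hk⟩ := not_forall.1 (mt (hs y) hy)
  exact ⟨{x | x - y ∈ mpow B X k}, fun x hx hxs => hk ⟨x, hxs, hx⟩,
    TopologicalSpace.isOpen_generateFrom_of_mem ⟨y, k, rfl⟩, by simp⟩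

variable [IsNoetherianRing B]

theorem mpow_eq_smul_top (k : ℕ) : mpow B X k = maximalIdeal B ^ k • ⊤ :=
  (AdicCompletion.pow_smul_top_eq_ker_eval (IsNoetherian.noetherian _)).symm

theorem map_mem_mpow (f : CTP B X →ₗ[B] CTP B Y) {k : ℕ} {x : CTP B X} (hx : x ∈ mpow B X k) :
    f x ∈ mpow B Y k := by
  rw [mpow_eq_smul_top] at hx ⊢
  have h := Submodule.mem_map_of_mem (f := f) hx
  rw [Submodule.map_smul''] at h
  exact Submodule.smul_mono le_rfl le_top h

theorem map_mem_mpow_succ {f : CTP B X →ₗ[B] CTP B Y} (hf : ∀ x, f x ∈ mpow B Y 1) {k : ℕ}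
    {x : CTP B X} (hx : x ∈ mpow B X k) : f x ∈ mpow B Y (k + 1) := by
  rw [mpow_eq_smul_top] at hx ⊢
  have h := Submodule.mem_map_of_mem (f := f) hx
  rw [Submodule.map_smul''] at h
  rw [pow_succ, ← smul_eq_mul, Submodule.smul_assoc]
  refine Submodule.smul_mono le_rfl ?_ h
  rintro _ ⟨z, -, rfl⟩
  simpa [mpow_eq_smul_top] using hf z

/-- A `B`-linear map with vanishing leading term takes values in `𝔪Y`. -/
theorem map_mem_mpow_one {f : CTP B X →ₗ[B] CTP B Y} (hf : ∀ x, f (iota B X x) ∈ mpow B Y 1)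
    (z : CTP B X) : f z ∈ mpow B Y 1 := by
  obtain ⟨t, ht⟩ := Submodule.mkQ_surjective _
    (AdicCompletion.eval (maximalIdeal B) (B ⊗[ℂ] X) 1 z)
  have hz : z - AdicCompletion.of (maximalIdeal B) (B ⊗[ℂ] X) t ∈ mpow B X 1 := by
    rw [mpow, LinearMap.mem_ker, map_sub, AdicCompletion.eval_of, ht, sub_self]
  have hof : f (AdicCompletion.of (maximalIdeal B) (B ⊗[ℂ] X) t) ∈ mpow B Y 1 := by
    clear ht hz
    induction t using TensorProduct.induction_on with
    | zero => simp
    | add s t hs ht => rw [map_add, map_add]; exact add_mem hs ht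
    | tmul b x =>
      have hb : b ⊗ₜ[ℂ] x = b • ((1 : B) ⊗ₜ[ℂ] x) := by simp [TensorProduct.smul_tmul']
      rw [hb, map_smul, map_smul]
      exact Submodule.smul_mem _ _ (hf x)
  have h := add_mem (map_mem_mpow f hz) hof
  rwa [← map_add, sub_add_cancel] at h

theorem mem_mpow_of_map_mem {f : CTP B X →ₗ[B] CTP B X} (hf : ∀ x, f x - x ∈ mpow B X 1) {k : ℕ}
    {x : CTP B X} (hx : f x ∈ mpow B X k) : x ∈ mpow B X k := by
  induction k with
  | zero => simp [mpow_eq_smul_top]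
  | succ k ih =>
    have hle : mpow B X (k + 1) ≤ mpow B X k := by
      simp only [mpow_eq_smul_top]
      exact Submodule.smul_mono_left (Ideal.pow_le_pow_right k.le_succ)
    have h := map_mem_mpow_succ (f := f - LinearMap.id) hf (ih (hle hx))
    simpa using sub_mem hx h

theorem surjective_of_sub_mem_mpow_one {f : CTP B X →ₗ[B] CTP B X}
    (hf : ∀ x, f x - x ∈ mpow B X 1) : Function.Surjective f := by
  have : IsAdicComplete (maximalIdeal B) (CTP B X) :=
    AdicCompletion.isAdicComplete (IsNoetherian.noetherian _)
  refine surjective_of_mkQ_comp_surjective (I := maximalIdeal B) fun y => ?_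
  obtain ⟨x, rfl⟩ := Submodule.mkQ_surjective _ y
  refine ⟨x, (Submodule.Quotient.eq _).2 ?_⟩
  simpa [mpow_eq_smul_top] using hf x

end Filtration

/-- If the leading term `φ₀ : X → Y` of a `B`-linear map
`φ : B ⊗̂ X → B ⊗̂ Y` is injective, then the image `φ(B ⊗̂ X)` is closed in `B ⊗̂ Y`
for the `𝔪`-adic topology. -/
theorem image_closed_of_leading_term_injective
    (B : Type) [CommRing B] [Algebra ℂ B] [IsNoetherianRing B] [IsLocalRing B]
    [IsAdicComplete (maximalIdeal B) B]
    (hres : Function.Bijective (algebraMap ℂ (ResidueField B)))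
    (X Y : Type) [AddCommGroup X] [Module ℂ X] [AddCommGroup Y] [Module ℂ Y]
    (φ : CTP B X →ₗ[B] CTP B Y) (φ₀ : X →ₗ[ℂ] Y)
    (hlead : ∀ x : X, φ (iota B X x) - iota B Y (φ₀ x) ∈ mpow B Y 1)
    (hinj : Function.Injective φ₀) :
    @IsClosed (CTP B Y) (adicTop B Y) (Set.range φ) := by
  obtain ⟨p, hp⟩ := φ₀.exists_leftInverse_of_injective (LinearMap.ker_eq_bot.2 hinj)
  let P : CTP B Y →ₗ[B] CTP B X :=
    (AdicCompletion.map (maximalIdeal B) (p.baseChange B)).restrictScalars B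
  have hP (x : X) : P (iota B Y (φ₀ x)) = iota B X x := by
    change AdicCompletion.map _ _ (AdicCompletion.of _ _ _) = _
    rw [AdicCompletion.map_of, LinearMap.baseChange_tmul, ← LinearMap.comp_apply, hp]
    rfl
  have hΨ (x : CTP B X) : (P ∘ₗ φ) x - x ∈ mpow B X 1 := by
    refine map_mem_mpow_one (f := P ∘ₗ φ - LinearMap.id) (fun x => ?_) x
    have h := map_mem_mpow P (hlead x)
    rwa [map_sub, hP] at h
  refine isClosed_adicTop fun y hy => ?_
  obtain ⟨x, hx⟩ := surjective_of_sub_mem_mpow_one hΨ (P y)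
  refine ⟨x, sub_eq_zero.1 (eq_zero_of_forall_mem_mpow fun k => ?_)⟩
  obtain ⟨_, ⟨x', rfl⟩, hx'⟩ := hy k
  have hxx' : x' - x ∈ mpow B X k := by
    refine mem_mpow_of_map_mem hΨ ?_
    rw [map_sub, hx, LinearMap.comp_apply, ← map_sub]
    exact map_mem_mpow P hx'
  have h := sub_mem hx' (map_mem_mpow φ hxx')
  rwa [map_sub, sub_sub_sub_cancel_left] at h
end

section
/- There is an internal direct sum decomposition of B-modules B⊗̂V = (B⊗̂H) ⊕ d_q(B⊗̂R) ⊕ (B⊗̂R), i.e., these three B-submodules of B⊗̂V are independent and their sum is all of B⊗̂V. -/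
/-!
`B` is a "deformation base": a commutative Noetherian local ℂ-algebra, complete in the
`𝔪`-adic topology, with residue field `ℂ`.  For a ℂ-vector space `X`, the completed
tensor product `B ⊗̂ X` is the `𝔪`-adic completion of `B ⊗[ℂ] X`, realized as the
inverse limit of the modules `(B ⊗[ℂ] X) ⧸ 𝔪^k (B ⊗[ℂ] X) ≅ B/𝔪^k ⊗[ℂ] X`.
-/

open scoped TensorProduct
open IsLocalRing

/-- For a ℂ-subspace `W ⊆ V`, the `B`-submodule `B ⊗̂ W ⊆ B ⊗̂ V`: those elements all of
whose finite-level components `(B ⊗[ℂ] V) ⧸ 𝔪^n (B ⊗[ℂ] V)` come from `B ⊗[ℂ] W`. -/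
noncomputable def csub (B : Type) [CommRing B] [Algebra ℂ B] [IsLocalRing B]
    (V : Type) [AddCommGroup V] [Module ℂ V] (W : Submodule ℂ V) :
    Submodule B (CTP B V) :=
  ⨅ n : ℕ, Submodule.comap
    (AdicCompletion.eval (maximalIdeal B) (B ⊗[ℂ] V) n)
    (LinearMap.range ((Submodule.mkQ ((maximalIdeal B) ^ n • ⊤)).comp
      ((W.subtype).baseChange B)))

/-- A linear endomorphism of a complete module that is congruent to the identity is bijective. -/
theorem bijective_of_sub_mem_smul_top {A M : Type*} [CommRing A] [AddCommGroup M] [Module A M]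
    (J : Ideal A) [IsAdicComplete J M] (T : M →ₗ[A] M)
    (hT : ∀ x, T x - x ∈ (J • ⊤ : Submodule A M)) : Function.Bijective T := by
  constructor
  · rw [← LinearMap.ker_eq_bot, LinearMap.ker_eq_bot']
    intro x hx
    refine IsHausdorff.haus (I := J) inferInstance x fun n => ?_
    rw [SModEq.zero]
    have hstep : ∀ n : ℕ, ∀ y ∈ (J ^ n • ⊤ : Submodule A M),
        T y - y ∈ (J ^ (n + 1) • ⊤ : Submodule A M) := by
      intro n y hy
      have hle : (J ^ n • ⊤ : Submodule A M) ≤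
          (J ^ (n + 1) • ⊤ : Submodule A M).comap (T - LinearMap.id) := by
        rw [Submodule.smul_le]
        intro r hr m _
        rw [Submodule.mem_comap, map_smul, pow_succ, Submodule.mul_smul]
        exact Submodule.smul_mem_smul hr (hT m)
      exact hle hy
    induction n with
    | zero => simp
    | succ n ih => simpa [hx] using hstep n x ih
  · refine surjective_of_mkQ_comp_surjective (I := J) fun y => ?_
    obtain ⟨x, rfl⟩ := Submodule.mkQ_surjective _ y
    exact ⟨x, (Submodule.Quotient.eq _).2 (hT x)⟩

/-- The `B`-linear extension of a `ℂ`-linear endomorphism of `V` to `B ⊗̂ V`. -/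
noncomputable def ctpMap (B : Type) [CommRing B] [Algebra ℂ B] [IsLocalRing B]
    {V : Type} [AddCommGroup V] [Module ℂ V] (f : V →ₗ[ℂ] V) : CTP B V →ₗ[B] CTP B V :=
  (AdicCompletion.map (maximalIdeal B) (f.baseChange B)).restrictScalars B

section ctpMap

variable {B : Type} [CommRing B] [Algebra ℂ B] [IsLocalRing B]
  {V : Type} [AddCommGroup V] [Module ℂ V]

theorem ctpMap_iota (f : V →ₗ[ℂ] V) (v : V) : ctpMap B f (iota B V v) = iota B V (f v) := by
  rw [ctpMap, LinearMap.restrictScalars_apply, iota, AdicCompletion.map_of,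
    LinearMap.baseChange_tmul, iota]

theorem eval_ctpMap (f : V →ₗ[ℂ] V) {x : CTP B V} {n : ℕ} {m : B ⊗[ℂ] V}
    (hm : AdicCompletion.eval (maximalIdeal B) (B ⊗[ℂ] V) n x = Submodule.Quotient.mk m) :
    AdicCompletion.eval (maximalIdeal B) (B ⊗[ℂ] V) n (ctpMap B f x) =
      Submodule.Quotient.mk (f.baseChange B m) := by
  change (f.baseChange B).reduceModIdeal _ (x.val n) = _
  rw [AdicCompletion.eval_apply] at hm
  rw [hm, LinearMap.reduceModIdeal_apply]

theorem ctpMap_comp_apply (f g : V →ₗ[ℂ] V) (x : CTP B V) :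
    ctpMap B f (ctpMap B g x) = ctpMap B (f ∘ₗ g) x := by
  simp only [ctpMap, LinearMap.restrictScalars_apply, AdicCompletion.map_comp_apply,
    LinearMap.baseChange_comp]

theorem ctpMap_id_apply (x : CTP B V) : ctpMap B (LinearMap.id : V →ₗ[ℂ] V) x = x := by
  simp [ctpMap, AdicCompletion.map_id]

theorem ctpMap_zero_apply (x : CTP B V) : ctpMap B (0 : V →ₗ[ℂ] V) x = 0 := by
  simp [ctpMap, AdicCompletion.map_zero]

theorem ctpMap_mem_csub {W : Submodule ℂ V} {f : V →ₗ[ℂ] V} (hf : ∀ v, f v ∈ W) (x : CTP B V) :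
    ctpMap B f x ∈ csub B V W := by
  rw [csub, Submodule.mem_iInf]
  intro n
  obtain ⟨m, hm⟩ := Submodule.Quotient.mk_surjective _
    (AdicCompletion.eval (maximalIdeal B) (B ⊗[ℂ] V) n x)
  rw [Submodule.mem_comap, eval_ctpMap f hm.symm]
  refine ⟨(f.codRestrict W hf).baseChange B m, ?_⟩
  rw [LinearMap.comp_apply, ← LinearMap.comp_apply (LinearMap.baseChange B W.subtype),
    ← LinearMap.baseChange_comp, LinearMap.subtype_comp_codRestrict, Submodule.mkQ_apply]

theorem ctpMap_congr {W : Submodule ℂ V} {f g : V →ₗ[ℂ] V} (hfg : ∀ v ∈ W, f v = g v)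
    {x : CTP B V} (hx : x ∈ csub B V W) : ctpMap B f x = ctpMap B g x := by
  refine AdicCompletion.ext fun n => ?_
  rw [csub, Submodule.mem_iInf] at hx
  obtain ⟨w, hw⟩ := hx n
  have hcomp : f ∘ₗ W.subtype = g ∘ₗ W.subtype := LinearMap.ext fun v => hfg v v.2
  rw [← AdicCompletion.eval_apply, ← AdicCompletion.eval_apply, eval_ctpMap f hw.symm,
    eval_ctpMap g hw.symm, ← LinearMap.comp_apply, ← LinearMap.comp_apply (g.baseChange B),
    ← LinearMap.baseChange_comp, ← LinearMap.baseChange_comp, hcomp]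

theorem ctpMap_eq_self {W : Submodule ℂ V} {f : V →ₗ[ℂ] V} (hf : ∀ v ∈ W, f v = v)
    {x : CTP B V} (hx : x ∈ csub B V W) : ctpMap B f x = x :=
  (ctpMap_congr (g := LinearMap.id) hf hx).trans (ctpMap_id_apply x)

theorem ctpMap_eq_zero {W : Submodule ℂ V} {f : V →ₗ[ℂ] V} (hf : ∀ v ∈ W, f v = 0)
    {x : CTP B V} (hx : x ∈ csub B V W) : ctpMap B f x = 0 :=
  (ctpMap_congr (g := 0) hf hx).trans (ctpMap_zero_apply x)

theorem mpow_one_eq [IsNoetherianRing B] :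
    mpow B V 1 = maximalIdeal B • (⊤ : Submodule B (CTP B V)) := by
  rw [mpow, ← AdicCompletion.pow_smul_top_eq_ker_eval (maximalIdeal B).fg_of_isNoetherianRing,
    pow_one]

/-- A `B`-linear map whose leading term vanishes takes values in `𝔪 V`. -/
theorem map_mem_mpow_one_of_iota [IsNoetherianRing B] (N : CTP B V →ₗ[B] CTP B V)
    (hN : ∀ v, N (iota B V v) ∈ mpow B V 1) (x : CTP B V) : N x ∈ mpow B V 1 := by
  obtain ⟨m, hm⟩ := Submodule.Quotient.mk_surjective _
    (AdicCompletion.eval (maximalIdeal B) (B ⊗[ℂ] V) 1 x)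
  have hof : N (AdicCompletion.of _ _ m) ∈ mpow B V 1 := by
    induction m using TensorProduct.induction_on generalizing x with
    | zero => simp
    | tmul b v =>
      have : b ⊗ₜ[ℂ] v = b • ((1 : B) ⊗ₜ[ℂ] v) := by simp [TensorProduct.smul_tmul']
      rw [this, map_smul, map_smul]
      exact Submodule.smul_mem _ b (hN v)
    | add m₁ m₂ h₁ h₂ =>
      rw [map_add, map_add]
      exact add_mem (h₁ (AdicCompletion.of _ _ m₁) rfl) (h₂ (AdicCompletion.of _ _ m₂) rfl)
  have hsub : x - AdicCompletion.of _ _ m ∈ mpow B V 1 := by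
    rw [mpow, LinearMap.mem_ker, map_sub, ← hm, AdicCompletion.eval_of, Submodule.mkQ_apply,
      sub_self]
  have hNsub : N (x - AdicCompletion.of _ _ m) ∈ mpow B V 1 := by
    rw [mpow_one_eq] at hsub ⊢
    have := Submodule.mem_map_of_mem (f := N) hsub
    rw [Submodule.map_smul''] at this
    exact Submodule.smul_mono le_rfl le_top this
  simpa using add_mem hNsub hof

end ctpMap

/-- The coordinate projections of a splitting `V = H ⊕ I ⊕ R`, together with a homotopy `s`
inverting `d` on `I`. -/
theorem exists_splitting_maps {V : Type*} [AddCommGroup V] [Module ℂ V]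
    {H I R : Submodule ℂ V} {d : V →ₗ[ℂ] V} (hsup : H ⊔ I ⊔ R = ⊤)
    (hdisjH : Disjoint H (I ⊔ R)) (hdisjIR : Disjoint I R)
    (hI : I = LinearMap.range d) (hker : LinearMap.ker d = H ⊔ I) :
    ∃ p r s : V →ₗ[ℂ] V,
      (∀ v, p v ∈ H) ∧ (∀ v, r v ∈ R) ∧ (∀ v, s v ∈ R) ∧
      (∀ v ∈ H, p v = v ∧ r v = 0 ∧ s v = 0) ∧
      (∀ v ∈ R, p v = 0 ∧ r v = v ∧ s v = 0) ∧
      (∀ v ∈ R, p (d v) = 0 ∧ r (d v) = 0 ∧ s (d v) = v) ∧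
      ∀ v, p v + d (s v) + r v = v := by
  have hdI : ∀ v, d v ∈ I := fun v => hI ▸ LinearMap.mem_range_self d v
  have hcH : IsCompl H (I ⊔ R) := ⟨hdisjH, codisjoint_iff.2 (by rw [← sup_assoc, hsup])⟩
  have hcR : IsCompl R (H ⊔ I) :=
    ⟨(hdisjIR.disjoint_sup_left_of_disjoint_sup_right hdisjH).symm,
      codisjoint_iff.2 (by rw [sup_comm, hsup])⟩
  have hinj : LinearMap.ker (d ∘ₗ R.subtype) = ⊥ := by
    rw [LinearMap.ker_eq_bot']
    intro v hv
    have : (v : V) ∈ H ⊔ I := hker ▸ hv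
    exact Subtype.ext (Submodule.disjoint_def.1 hcR.disjoint _ v.2 this)
  obtain ⟨g, hg⟩ := LinearMap.exists_leftInverse_of_injective _ hinj
  have hg' : ∀ v (hv : v ∈ R), g (d v) = ⟨v, hv⟩ := fun v hv => LinearMap.congr_fun hg ⟨v, hv⟩
  have hd0 : ∀ v ∈ H ⊔ I, d v = 0 := fun v hv => LinearMap.mem_ker.1 (hker ▸ hv)
  let p := H.projection _ hcH
  let r := R.projection _ hcR
  let q : V →ₗ[ℂ] V := LinearMap.id - p - r
  have hpH : ∀ v ∈ H, p v = v := fun v hv => Submodule.projection_apply_of_mem_left hcH hv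
  have hp0 : ∀ v ∈ I ⊔ R, p v = 0 := fun v hv => (Submodule.projection_apply_eq_zero_iff hcH).2 hv
  have hrR : ∀ v ∈ R, r v = v := fun v hv => Submodule.projection_apply_of_mem_left hcR hv
  have hr0 : ∀ v ∈ H ⊔ I, r v = 0 := fun v hv => (Submodule.projection_apply_eq_zero_iff hcR).2 hv
  have hHr : ∀ v ∈ H, r v = 0 := fun v hv => hr0 v (Submodule.mem_sup_left hv)
  have hIr : ∀ v ∈ I, r v = 0 := fun v hv => hr0 v (Submodule.mem_sup_right hv)
  have hIp : ∀ v ∈ I, p v = 0 := fun v hv => hp0 v (Submodule.mem_sup_left hv)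
  have hRp : ∀ v ∈ R, p v = 0 := fun v hv => hp0 v (Submodule.mem_sup_right hv)
  have hq : ∀ v, q v = v - p v - r v := fun v => rfl
  have hdgI : ∀ v ∈ I, d (g v) = v := by
    intro v hv
    rw [hI] at hv
    obtain ⟨u, rfl⟩ := hv
    have hu : d u = d (r u) := by
      rw [← sub_eq_zero, ← map_sub]
      exact hd0 _ (Submodule.sub_projection_mem hcR u)
    rw [hu, hg' (r u) (Submodule.projection_apply_mem hcR u)]
  have hqI : ∀ v, q v ∈ I := by
    intro v
    obtain ⟨y, hy, c, hc, rfl⟩ := Submodule.mem_sup.1 (hsup ▸ Submodule.mem_top : v ∈ H ⊔ I ⊔ R)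
    obtain ⟨a, ha, b, hb, rfl⟩ := Submodule.mem_sup.1 hy
    have : q (a + b + c) = b := by
      rw [hq]
      simp only [map_add, hpH a ha, hIp b hb, hRp c hc, hHr a ha, hIr b hb, hrR c hc]
      abel
    rwa [this]
  refine ⟨p, r, R.subtype ∘ₗ g ∘ₗ q, Submodule.projection_apply_mem hcH,
    Submodule.projection_apply_mem hcR, fun v => (g (q v)).2, fun v hv => ⟨hpH v hv, hHr v hv, ?_⟩,
    fun v hv => ⟨hRp v hv, hrR v hv, ?_⟩,
    fun v hv => ⟨hIp _ (hdI v), hIr _ (hdI v), ?_⟩, fun v => ?_⟩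
  · simp [hq, hpH v hv, hHr v hv]
  · simp [hq, hRp v hv, hrR v hv]
  · simp [hq, hIp _ (hdI v), hIr _ (hdI v), hg' v hv]
  · have : d ((R.subtype ∘ₗ g ∘ₗ q) v) = q v := hdgI _ (hqI v)
    rw [this, hq]
    abel

/-- There is an internal direct sum decomposition of `B`-modules
`B ⊗̂ V = (B ⊗̂ H) ⊕ d_q(B ⊗̂ R) ⊕ (B ⊗̂ R)`: the three submodules are independent and
their sum is everything. -/
theorem deformed_decomposition
    (B : Type) [CommRing B] [Algebra ℂ B] [IsNoetherianRing B] [IsLocalRing B]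
    [IsAdicComplete (maximalIdeal B) B]
    (hres : Function.Bijective (algebraMap ℂ (ResidueField B)))
    (V : Type) [AddCommGroup V] [Module ℂ V]
    (H I R : Submodule ℂ V) (d : V →ₗ[ℂ] V)
    (hsup : H ⊔ I ⊔ R = ⊤)
    (hdisjH : Disjoint H (I ⊔ R)) (hdisjIR : Disjoint I R)
    (hI : I = LinearMap.range d)
    (hker : LinearMap.ker d = H ⊔ I)
    (dq : CTP B V →ₗ[B] CTP B V)
    (hlead : ∀ v : V, dq (iota B V v) - iota B V (d v) ∈ mpow B V 1) :
    Disjoint (csub B V H) (Submodule.map dq (csub B V R) ⊔ csub B V R) ∧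
    Disjoint (Submodule.map dq (csub B V R)) (csub B V R) ∧
    csub B V H ⊔ Submodule.map dq (csub B V R) ⊔ csub B V R = ⊤ := by
  obtain ⟨p, r, s, hpH, hrR, hsR, hH, hR, hdR, hsum⟩ :=
    exists_splitting_maps hsup hdisjH hdisjIR hI hker
  have := AdicCompletion.isAdicComplete (M := B ⊗[ℂ] V) (maximalIdeal B).fg_of_isNoetherianRing
  let T : CTP B V →ₗ[B] CTP B V := ctpMap B p + dq ∘ₗ ctpMap B s + ctpMap B r
  have hT : ∀ x, T x = ctpMap B p x + dq (ctpMap B s x) + ctpMap B r x := fun x => rfl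
  have hbij : Function.Bijective T := by
    refine bijective_of_sub_mem_smul_top (maximalIdeal B) T fun x => ?_
    rw [← mpow_one_eq]
    refine map_mem_mpow_one_of_iota (T - (LinearMap.id : CTP B V →ₗ[B] CTP B V)) (fun v => ?_) x
    have hv : iota B V v = iota B V (p v) + iota B V (d (s v)) + iota B V (r v) := by
      conv_lhs => rw [← hsum v]
      simp [iota, TensorProduct.tmul_add]
    have hTv : (T - (LinearMap.id : CTP B V →ₗ[B] CTP B V)) (iota B V v) = dq (iota B V (s v)) - iota B V (d (s v)) := by
      rw [LinearMap.sub_apply, LinearMap.id_apply, hT, ctpMap_iota, ctpMap_iota, ctpMap_iota]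
      conv_lhs => rw [hv]
      abel
    rw [hTv]
    exact hlead (s v)
  have hindep : ∀ x ∈ csub B V H, ∀ y ∈ csub B V R, ∀ z ∈ csub B V R,
      x + dq y + z = 0 → x = 0 ∧ y = 0 ∧ z = 0 := by
    intro x hx y hy z hz h
    let u := x + ctpMap B d y + z
    have hpu : ctpMap B p u = x := by
      simp only [u, map_add]
      rw [ctpMap_eq_self (fun v hv => (hH v hv).1) hx, ctpMap_comp_apply,
        ctpMap_eq_zero (f := p ∘ₗ d) (fun v hv => (hdR v hv).1) hy,
        ctpMap_eq_zero (fun v hv => (hR v hv).1) hz, add_zero, add_zero]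
    have hsu : ctpMap B s u = y := by
      simp only [u, map_add]
      rw [ctpMap_eq_zero (fun v hv => (hH v hv).2.2) hx, ctpMap_comp_apply,
        ctpMap_eq_self (f := s ∘ₗ d) (fun v hv => (hdR v hv).2.2) hy,
        ctpMap_eq_zero (fun v hv => (hR v hv).2.2) hz, add_zero, zero_add]
    have hru : ctpMap B r u = z := by
      simp only [u, map_add]
      rw [ctpMap_eq_zero (fun v hv => (hH v hv).2.1) hx, ctpMap_comp_apply,
        ctpMap_eq_zero (f := r ∘ₗ d) (fun v hv => (hdR v hv).2.1) hy,
        ctpMap_eq_self (fun v hv => (hR v hv).2.1) hz, zero_add, zero_add]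
    have hu : u = 0 := hbij.injective (by rw [hT, hpu, hsu, hru, h, map_zero])
    rw [hu, map_zero] at hpu hsu hru
    exact ⟨hpu.symm, hsu.symm, hru.symm⟩
  refine ⟨Submodule.disjoint_def.2 ?_, Submodule.disjoint_def.2 ?_, eq_top_iff.2 ?_⟩
  · intro x hx hx'
    obtain ⟨_, ⟨y, hy, rfl⟩, z, hz, rfl⟩ := Submodule.mem_sup.1 hx'
    refine neg_eq_zero.1 (hindep _ (neg_mem hx) y hy z hz ?_).1
    abel
  · rintro _ ⟨y, hy, rfl⟩ hy'
    refine neg_eq_zero.1 (hindep 0 (zero_mem _) y hy _ (neg_mem hy') ?_).2.2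
    abel
  · intro x _
    obtain ⟨u, rfl⟩ := hbij.surjective x
    rw [hT]
    exact Submodule.add_mem_sup (Submodule.add_mem_sup (ctpMap_mem_csub hpH u)
      (Submodule.mem_map_of_mem (ctpMap_mem_csub hsR u))) (ctpMap_mem_csub hrR u)
end
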